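/- arXiv:2504.18801 — 2 statements merged into one kernel-verified Lean document; each statement's English description precedes it below -/
import Mathlib

section
/- Let a ∈ (0,1), b > 0, let m ≥ 1 be a natural number, and set u = b(1−a). If u² ≤ m a², then [m a + (1−a) b]² ≤ K · [ (1−a)² b²/2 + m a (1−a) b + m(m−1) a²/2 ], where K^{-1} = (1/2)·(1 − a²/(b(1−a) + a)²). -/
/-- The n = 1 induction step. Let a ∈ (0,1), b > 0, m ≥ 1, u = b(1−a).
If u² ≤ m a², then [ma + (1−a)b]² ≤ K·[(1−a)²b²/2 + ma(1−a)b + m(m−1)a²/2],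
where K⁻¹ = (1/2)·(1 − a²/(b(1−a) + a)²). -/
theorem induction_step_n_eq_one
    (a b : ℝ) (ha : a ∈ Set.Ioo (0 : ℝ) 1) (hb : 0 < b)
    (m : ℕ) (hm : 1 ≤ m) (u : ℝ) (hu : u = b * (1 - a))
    (hineq : u ^ 2 ≤ (m : ℝ) * a ^ 2)
    (K : ℝ) (hK : K⁻¹ = (1 / 2) * (1 - a ^ 2 / (b * (1 - a) + a) ^ 2)) :
    ((m : ℝ) * a + (1 - a) * b) ^ 2
      ≤ K * ((1 - a) ^ 2 * b ^ 2 / 2 + (m : ℝ) * a * (1 - a) * b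
              + (m : ℝ) * ((m : ℝ) - 1) * a ^ 2 / 2) := by
  obtain ⟨ha0, ha1⟩ := ha
  have hu0 : 0 < u := hu ▸ mul_pos hb (sub_pos.2 ha1)
  have hm1 : (1 : ℝ) ≤ m := by exact_mod_cast hm
  rw [← hu] at hK
  have hd : 0 < (u + a) ^ 2 := by positivity
  have hKinv : 0 < K⁻¹ := by
    rw [hK]
    have : a ^ 2 / (u + a) ^ 2 < 1 := by
      rw [div_lt_one hd]
      nlinarith [mul_pos hu0 ha0]
    linarith
  have hmain : (m : ℝ) ≤ (m * a + u) ^ 2 / (u + a) ^ 2 := by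
    rw [le_div_iff₀ hd]
    nlinarith [mul_nonneg (sub_nonneg.2 hm1) (sub_nonneg.2 hineq)]
  have hquad : (1 - a) ^ 2 * b ^ 2 / 2 + (m : ℝ) * a * (1 - a) * b
      + (m : ℝ) * ((m : ℝ) - 1) * a ^ 2 / 2 = ((m * a + u) ^ 2 - m * a ^ 2) / 2 := by
    rw [hu]
    ring
  rw [hquad, mul_comm (1 - a) b, ← hu, ← inv_mul_le_iff₀ (inv_pos.1 hKinv), hK]
  have hscaled := mul_le_mul_of_nonneg_right hmain (sq_nonneg a)
  calc 1 / 2 * (1 - a ^ 2 / (u + a) ^ 2) * (m * a + u) ^ 2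
      = ((m * a + u) ^ 2 - (m * a + u) ^ 2 / (u + a) ^ 2 * a ^ 2) / 2 := by ring
    _ ≤ ((m * a + u) ^ 2 - m * a ^ 2) / 2 := by linarith
end

section
/- Let K > 0, let p ∈ (0,1), and let g : ℤ≥0 → [0,∞) satisfy g(j)² ≤ K · g(j+1) · g(j−1) for every j ≥ 1. Define h : ℤ≥0 → [0,∞) by h(n) = (1−p) g(n) + p g(n−1) for n ≥ 1 and h(0) = (1−p) g(0). Then for every n ≥ 2, h(n)² ≤ K · h(n+1) · h(n−1). -/
/-- Two consecutive semi-log-convexity inequalities bound the mixed term. -/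
theorem two_mul_mul_le_of_sq_le {K a b c d : ℝ} (hK : 0 < K)
    (ha : 0 ≤ a) (hb : 0 ≤ b) (hc : 0 ≤ c) (hd : 0 ≤ d)
    (hbK : b ^ 2 ≤ K * c * a) (hcK : c ^ 2 ≤ K * d * b) :
    2 * (b * c) ≤ K * (d * a + c * b) := by
  rcases (mul_nonneg hb hc).eq_or_lt with hbc | hbc
  · rw [← hbc]
    simp only [mul_zero]
    positivity
  · have hprod : b * c * (b * c) ≤ K ^ 2 * (d * a) * (b * c) := by
      have := mul_le_mul hbK hcK (sq_nonneg c) (by positivity)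
      linarith
    have hle : b * c ≤ K ^ 2 * (d * a) := le_of_mul_le_mul_right hprod hbc
    refine le_of_mul_le_mul_left ?_ hK
    nlinarith [mul_nonneg hbc.le (sq_nonneg (K - 1))]

/-- Semi-log-convexity is preserved under convolution with a Bernoulli
law. If g : ℤ≥0 → [0,∞) satisfies g(j)² ≤ K g(j+1) g(j−1) for all j ≥ 1, and
h(n) = (1−p) g(n) + p g(n−1) for n ≥ 1 with h(0) = (1−p) g(0), then
h(n)² ≤ K h(n+1) h(n−1) for every n ≥ 2. -/
theorem bernoulli_convolution_preserves_semi_log_convexity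
    (K : ℝ) (hK : 0 < K) (p : ℝ) (hp : p ∈ Set.Ioo (0 : ℝ) 1)
    (g : ℕ → ℝ) (hg0 : ∀ n, 0 ≤ g n)
    (hg : ∀ j : ℕ, 1 ≤ j → g j ^ 2 ≤ K * g (j + 1) * g (j - 1))
    (h : ℕ → ℝ) (hh0' : ∀ n, 0 ≤ h n)
    (hh0 : h 0 = (1 - p) * g 0)
    (hh : ∀ n : ℕ, 1 ≤ n → h n = (1 - p) * g n + p * g (n - 1)) :
    ∀ n : ℕ, 2 ≤ n → h n ^ 2 ≤ K * h (n + 1) * h (n - 1) := by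
  intro n hn
  obtain ⟨m, rfl⟩ := Nat.exists_eq_add_of_le' hn
  obtain ⟨hp0, hp1⟩ := hp
  have hbK : g (m + 1) ^ 2 ≤ K * g (m + 2) * g m := hg (m + 1) (by omega)
  have hcK : g (m + 2) ^ 2 ≤ K * g (m + 3) * g (m + 1) := hg (m + 2) (by omega)
  have h1 : h (m + 1) = (1 - p) * g (m + 1) + p * g m := hh (m + 1) (by omega)
  have h2 : h (m + 2) = (1 - p) * g (m + 2) + p * g (m + 1) := hh (m + 2) (by omega)
  have h3 : h (m + 3) = (1 - p) * g (m + 3) + p * g (m + 2) := hh (m + 3) (by omega)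
  have hmix := two_mul_mul_le_of_sq_le hK (hg0 _) (hg0 _) (hg0 _) (hg0 _) hbK hcK
  change h (m + 2) ^ 2 ≤ K * h (m + 3) * h (m + 1)
  rw [h1, h2, h3]
  have hb := mul_le_mul_of_nonneg_left hbK (sq_nonneg p)
  have hc := mul_le_mul_of_nonneg_left hcK (sq_nonneg (1 - p))
  have hm := mul_le_mul_of_nonneg_left hmix (mul_nonneg hp0.le (sub_nonneg.2 hp1.le))
  linarith
end
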